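/- Let A be a partition of length at most l, J a subdivision of {1,…,l}, and m, n ∈ {1,…,ι} such that H_J(A,m,n) is a partition and such that either m < n, or m = n and |I_m| > 1. Let P ≻ P' be partitions of length at most l and equal weight whose Young diagrams differ by single boxes, Y(P) \ Y(P') = {(α, α')} and Y(P') \ Y(P) = {(γ, γ')}, with J(α) ≤ m and n ≤ J(γ). Then G_J(A) + P' has positive multiplicity in the product of Schur functions s_{H_J(A,m,n)} · s_P. -/

import Mathlib

open Finset MvPolynomial

/-- `hp l k` is the complete homogeneous symmetric polynomial `h_k` in `l` variables,
interpreted as `0` for negative `k` (and `h_0 = 1`). -/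
noncomputable def hp (l : ℕ) (k : ℤ) : MvPolynomial (Fin l) ℤ :=
  if 0 ≤ k then MvPolynomial.hsymm (Fin l) ℤ k.toNat else 0

/-- The Schur polynomial of a partition (given as a weakly decreasing `l`-tuple) in `l`
variables, defined by the Jacobi–Trudi determinant `s_A = det (h_{A i - i + j})`. -/
noncomputable def schur (l : ℕ) (A : Fin l → ℕ) : MvPolynomial (Fin l) ℤ :=
  Matrix.det (Matrix.of fun i j : Fin l => hp l ((A i : ℤ) + (j : ℕ) - (i : ℕ)))

/-- The Vandermonde alternant `a_δ = det (x_i ^ (l - 1 - j))`. -/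
noncomputable def vdm (l : ℕ) : MvPolynomial (Fin l) ℤ :=
  Matrix.det (Matrix.of fun i j : Fin l => (X i : MvPolynomial (Fin l) ℤ) ^ (l - 1 - (j : ℕ)))

/-- The multiplicity (coefficient) of the Schur polynomial `s_B` in the expansion of a
symmetric polynomial `P` in the basis of Schur polynomials of partitions of length at most
`l`: it equals the coefficient of the monomial `x ^ (B + δ)` in the alternating polynomial
`P * a_δ`, where `δ = (l-1, l-2, …, 0)`. -/
noncomputable def schurMult (l : ℕ) (B : Fin l → ℕ) (P : MvPolynomial (Fin l) ℤ) : ℤ :=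
  MvPolynomial.coeff (Finsupp.equivFunOnFinite.symm fun i : Fin l => B i + (l - 1 - (i : ℕ)))
    (P * vdm l)

/-- The Littlewood–Richardson coefficient `c^C_{A,B}` for partitions of length at most `l`,
as the multiplicity of `s_C` in `s_A * s_B` (this agrees with the structure constants of the
ring of symmetric functions in the Schur basis). -/
noncomputable def lrCoeff (l : ℕ) (A B C : Fin l → ℕ) : ℤ :=
  schurMult l C (schur l A * schur l B)

/-- Dominance: every partial sum of `A` is at least the corresponding partial sum of `B`. -/
def Dom (l : ℕ) (A B : Fin l → ℕ) : Prop :=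
  ∀ r : ℕ, ∑ i ∈ Finset.univ.filter (fun i : Fin l => (i : ℕ) < r), B i ≤
    ∑ i ∈ Finset.univ.filter (fun i : Fin l => (i : ℕ) < r), A i

/-- The Young diagram of `A` (0-based): boxes `(i, j)` with `j < A i`. -/
def YD (l : ℕ) (A : Fin l → ℕ) : Set (Fin l × ℕ) := {p | p.2 < A p.1}

/-- Size of block `I_j` of the subdivision of `{1,…,l}` encoded by the monotone
surjection `f : Fin l → Fin ι` (whose fibers are the consecutive blocks). -/
def bsize (l ι : ℕ) (f : Fin l → Fin ι) (j : Fin ι) : ℕ :=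
  (Finset.univ.filter fun i => f i = j).card

/-- The first (0-based) position of block `I_j`. -/
def bstart (l ι : ℕ) (f : Fin l → Fin ι) (j : Fin ι) : ℕ :=
  (Finset.univ.filter fun i => f i < j).card

/-- One past the last (0-based) position of block `I_j`. -/
def bend (l ι : ℕ) (f : Fin l → Fin ι) (j : Fin ι) : ℕ :=
  (Finset.univ.filter fun i => f i ≤ j).card

/-- The sum `|A[I_j]|` of the entries of `A` over block `I_j`. -/
def bsum (l ι : ℕ) (f : Fin l → Fin ι) (A : Fin l → ℕ) (j : Fin ι) : ℕ :=
  ∑ i ∈ Finset.univ.filter (fun i => f i = j), A i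

/-- `L(l) = lcm {1, …, l}`. -/
def Lnum (l : ℕ) : ℕ := (Finset.Icc 1 l).lcm id

/-- The partition `G_J(A)`: constant on each block `I_j`, with value `(L(l)/|I_j|)·|A[I_j]|`. -/
def GJ (l ι : ℕ) (f : Fin l → Fin ι) (A : Fin l → ℕ) : Fin l → ℕ :=
  fun i => (Lnum l / bsize l ι f (f i)) * bsum l ι f A (f i)

/-- `A` extended by zero beyond its `l` entries. -/
def pad (l : ℕ) (A : Fin l → ℕ) (m : ℕ) : ℕ := if h : m < l then A ⟨m, h⟩ else 0

/-- The position symmetric to `i` within its block (reversal of the block). -/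
def reflIdx (l ι : ℕ) (f : Fin l → Fin ι) (i : Fin l) : ℕ :=
  bstart l ι f (f i) + bend l ι f (f i) - 1 - (i : ℕ)

/-- `χ_J(A)`: on each block, the negatives of the entries of `A` in reversed order. -/
def chiJ (l ι : ℕ) (f : Fin l → Fin ι) (A : Fin l → ℕ) : Fin l → ℤ :=
  fun i => -(pad l A (reflIdx l ι f i) : ℤ)

/-- `H_J(A,m,n) = G_J(A) + E_J(m) + F_J(n)`: subtract `1` at the last position of block
`I_m` and add `1` at the first position of block `I_n`. -/
def HJ (l ι : ℕ) (f : Fin l → Fin ι) (A : Fin l → ℕ) (m n : Fin ι) : Fin l → ℤ :=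
  fun i => (GJ l ι f A i : ℤ) - (if (i : ℕ) = bend l ι f m - 1 then 1 else 0)
    + (if (i : ℕ) = bstart l ι f n then 1 else 0)


/-! ### Part 1: the bialternant formula -/

noncomputable def geo {R : Type*} [CommRing R] (x : R) : PowerSeries R := PowerSeries.mk fun n => x ^ n

theorem geo_mul {R : Type*} [CommRing R] (x : R) :
    geo x * (1 - PowerSeries.C x * PowerSeries.X) = 1 := by
  ext n
  rw [mul_sub, mul_one, map_sub, ← mul_assoc]
  cases n with
  | zero => simp [geo]
  | succ n =>
    rw [PowerSeries.coeff_succ_mul_X, mul_comm, PowerSeries.coeff_C_mul]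
    simp [geo, PowerSeries.coeff_one, pow_succ']

theorem coeff_prod_geo (l n : ℕ) :
    PowerSeries.coeff n (∏ i : Fin l, geo (X i : MvPolynomial (Fin l) ℤ)) = hsymm (Fin l) ℤ n := by
  classical
  rw [PowerSeries.coeff_prod, hsymm]
  simp only [geo, PowerSeries.coeff_mk]
  symm
  refine Finset.sum_bij (fun s _ => Multiset.toFinsupp s.1) ?_ ?_ ?_ ?_
  · intro s _
    rw [Finset.mem_finsuppAntidiag]
    refine ⟨?_, Finset.subset_univ _⟩
    change ∑ i, Multiset.count i s.1 = n
    rw [Multiset.sum_count_eq_card (fun a _ => Finset.mem_univ a)]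
    exact s.2
  · intro s _ t _ h
    exact Subtype.ext (Multiset.toFinsupp.injective h)
  · intro p hp
    rw [Finset.mem_finsuppAntidiag] at hp
    refine ⟨⟨Finsupp.toMultiset p, ?_⟩, Finset.mem_univ _, ?_⟩
    · rw [Finsupp.card_toMultiset, Finsupp.sum_fintype _ _ (by simp)]
      exact hp.1
    · simp
  · intro s _
    simp only [Multiset.toFinsupp_apply]
    rw [Finset.prod_multiset_map_count]
    refine Finset.prod_subset (Finset.subset_univ _) ?_
    intro i _ hi
    rw [Multiset.mem_toFinset] at hi
    rw [Multiset.count_eq_zero_of_notMem hi, pow_zero]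

noncomputable def Ek (l : ℕ) (k : Fin l) : Polynomial (MvPolynomial (Fin l) ℤ) :=
  ∏ i ∈ Finset.univ.erase k, (1 - Polynomial.C (X i) * Polynomial.X)

theorem Ek_natDegree (l : ℕ) (k : Fin l) : (Ek l k).natDegree ≤ l - 1 := by
  refine (Polynomial.natDegree_prod_le _ _).trans ?_
  refine (Finset.sum_le_sum (g := fun _ => 1) ?_).trans ?_
  · intro i _
    compute_degree
  · simp

theorem prod_geo_mul_Ek (l : ℕ) (k : Fin l) :
    (∏ i : Fin l, geo (X i : MvPolynomial (Fin l) ℤ)) * (Ek l k : PowerSeries _) = geo (X k) := by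
  rw [← Finset.mul_prod_erase _ _ (Finset.mem_univ k), mul_assoc]
  have : (Ek l k : PowerSeries (MvPolynomial (Fin l) ℤ)) =
      ∏ i ∈ Finset.univ.erase k, (1 - PowerSeries.C (X i) * PowerSeries.X) := by
    rw [Ek, ← Polynomial.coeToPowerSeries.ringHom_apply, map_prod]
    simp
  rw [this, ← Finset.prod_mul_distrib, Finset.prod_eq_one, mul_one]
  intro i _
  exact geo_mul _

theorem pow_eq_sum_hp (l : ℕ) (k : Fin l) (a : ℕ) :
    (X k : MvPolynomial (Fin l) ℤ) ^ a =
      ∑ j : Fin l, hp l ((a : ℤ) - ((l : ℤ) - 1 - (j : ℕ))) * (Ek l k).coeff (l - 1 - j) := by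
  have h1 : (X k : MvPolynomial (Fin l) ℤ) ^ a = PowerSeries.coeff a (geo (X k)) := by simp [geo]
  rw [h1, ← prod_geo_mul_Ek, mul_comm, PowerSeries.coeff_mul,
    Finset.Nat.sum_antidiagonal_eq_sum_range_succ_mk]
  simp only [coeff_prod_geo, Polynomial.coeff_coe]
  have h2 : ∑ j : Fin l, hp l ((a : ℤ) - ((l : ℤ) - 1 - (j : ℕ))) * (Ek l k).coeff (l - 1 - j)
      = ∑ s ∈ Finset.range l, hp l ((a : ℤ) - s) * (Ek l k).coeff s := by
    rw [Finset.sum_range, ← Equiv.sum_comp Fin.revPerm]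
    refine Finset.sum_congr rfl fun j _ => ?_
    have hj := j.2
    have e1 : ((Fin.rev j : Fin l) : ℕ) = l - 1 - j := by simp [Fin.rev]; omega
    have e2 : l - 1 - (l - 1 - (j : ℕ)) = j := by omega
    have e3 : (l : ℤ) - 1 - ((l - 1 - (j : ℕ) : ℕ) : ℤ) = (j : ℕ) := by omega
    simp only [Fin.revPerm_apply, e1, e2, e3]
  rw [h2]
  have h3 : ∑ s ∈ Finset.range (a + 1), (Ek l k).coeff s * hsymm (Fin l) ℤ (a - s) =
      ∑ s ∈ Finset.range (a + l + 1), hp l ((a : ℤ) - s) * (Ek l k).coeff s := by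
    rw [← Finset.sum_subset (Finset.range_mono (show a + 1 ≤ a + l + 1 by omega))]
    · refine Finset.sum_congr rfl fun s hs => ?_
      rw [Finset.mem_range] at hs
      rw [hp, if_pos (by omega), mul_comm]
      congr 2
      omega
    · intro s _ hs
      rw [Finset.mem_range] at hs
      rw [hp, if_neg (by omega), zero_mul]
  rw [h3]
  symm
  refine Finset.sum_subset (Finset.range_mono (by omega)) ?_
  intro s _ hs
  rw [Finset.mem_range] at hs
  rw [Polynomial.coeff_eq_zero_of_natDegree_lt, mul_zero]
  have := Ek_natDegree l k
  have := k.2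
  omega

/-- alternant -/
noncomputable def altv (l : ℕ) (u : Fin l → ℕ) : MvPolynomial (Fin l) ℤ :=
  Matrix.det (Matrix.of fun i j : Fin l => (X i : MvPolynomial (Fin l) ℤ) ^ (u j))

theorem alt_eq_schur_mul (l : ℕ) (P : Fin l → ℕ) :
    altv l (fun j => P j + (l - 1 - (j : ℕ))) = schur l P *
      Matrix.det (Matrix.of fun j k : Fin l => (Ek l k).coeff (l - 1 - j)) := by
  rw [schur, ← Matrix.det_mul, altv, ← Matrix.det_transpose]
  congr 1
  ext1 i k
  rw [Matrix.transpose_apply, Matrix.of_apply, Matrix.mul_apply, pow_eq_sum_hp]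
  refine Finset.sum_congr rfl fun j _ => ?_
  simp only [Matrix.of_apply]
  congr 2
  have := i.2
  omega

theorem schur_zero (l : ℕ) : schur l (fun _ => 0) = 1 := by
  rw [schur, Matrix.det_of_isUpperTriangular]
  · apply Finset.prod_eq_one
    intro i _
    simp [hp]
  · intro i j hij
    simp only [id] at hij
    rw [Matrix.of_apply, hp, if_neg]
    have : (j : ℕ) < i := hij
    push_cast
    omega

theorem schur_mul_vdm (l : ℕ) (P : Fin l → ℕ) :
    schur l P * vdm l = altv l (fun j => P j + (l - 1 - (j : ℕ))) := by
  have h := alt_eq_schur_mul l (fun _ => 0)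
  rw [schur_zero, one_mul] at h
  rw [alt_eq_schur_mul, ← h]
  simp [altv, vdm]

/-! ### Part 2: Gelfand–Tsetlin patterns and branching -/

noncomputable def extz (l : ℕ) (μ : Fin l → ℕ) : ℕ → ℕ := fun i => if h : i < l then μ ⟨i, h⟩ else 0

theorem extz_inj (l : ℕ) : Function.Injective (extz l) := by
  intro a b h
  funext i
  have := congrFun h i
  simpa [extz] using this

noncomputable def interl (l : ℕ) (lam : ℕ → ℕ) : Finset (ℕ → ℕ) :=
  (Fintype.piFinset fun i : Fin l => Finset.Icc (lam (i + 1)) (lam i)).map ⟨extz l, extz_inj l⟩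

theorem mem_interl {l : ℕ} {lam μ : ℕ → ℕ} : μ ∈ interl l lam ↔
    (∀ i < l, lam (i + 1) ≤ μ i ∧ μ i ≤ lam i) ∧ ∀ i, l ≤ i → μ i = 0 := by
  simp only [interl, Finset.mem_map, Fintype.mem_piFinset, Finset.mem_Icc, Function.Embedding.coeFn_mk]
  constructor
  · rintro ⟨a, ha, rfl⟩
    refine ⟨fun i hi => ?_, fun i hi => ?_⟩
    · simpa [extz, hi] using ha ⟨i, hi⟩
    · simp [extz, hi]
  · rintro ⟨h1, h2⟩
    refine ⟨fun i => μ i, fun i => h1 i i.2, ?_⟩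
    funext i
    by_cases hi : i < l
    · simp [extz, hi]
    · simp [extz, hi, h2 i (by omega)]

noncomputable def GT : ℕ → (ℕ → ℕ) → Finset (ℕ → ℕ → ℕ)
  | 0, lam => {fun _ => lam}
  | l + 1, lam => by
    classical
    exact ((interl l lam).sigma (fun μ => GT l μ)).image (fun p k => if k ≤ l then p.2 k else lam)

theorem mem_GT {l : ℕ} {lam : ℕ → ℕ} {g : ℕ → ℕ → ℕ} : g ∈ GT l lam ↔
    (∀ k, l ≤ k → g k = lam) ∧ ∀ k < l, g k ∈ interl k (g (k + 1)) := by
  induction l generalizing lam g with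
  | zero =>
    simp only [GT, Finset.mem_singleton]
    constructor
    · rintro rfl; simp
    · rintro ⟨h, _⟩; funext k; rw [h k (by omega)]
  | succ l ih =>
    simp only [GT, Finset.mem_image, Finset.mem_sigma, Sigma.exists]
    constructor
    · rintro ⟨μ, h, ⟨h1, h2⟩, rfl⟩
      rw [ih] at h2
      refine ⟨fun k hk => ?_, fun k hk => ?_⟩
      · simp [show ¬ k ≤ l by omega]
      · rcases Nat.lt_or_ge k l with hkl | hkl
        · simpa [show k ≤ l by omega, show k + 1 ≤ l by omega] using h2.2 k hkl
        · obtain rfl : k = l := by omega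
          simpa [h2.1 k le_rfl] using h1
    · rintro ⟨h1, h2⟩
      refine ⟨g l, fun k => if k ≤ l then g k else g l, ⟨?_, ?_⟩, ?_⟩
      · have := h2 l (by omega)
        rwa [h1 (l + 1) le_rfl] at this
      · rw [ih]
        refine ⟨fun k hk => ?_, fun k hk => ?_⟩
        · rcases Nat.lt_or_ge l k with hkl | hkl
          · simp [show ¬ k ≤ l by omega]
          · obtain rfl : k = l := by omega
            simp
        · simpa [show k ≤ l by omega, show k + 1 ≤ l by omega] using h2 k (by omega)
      · funext k
        by_cases hk : k ≤ l
        · simp [hk]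
        · simp [hk, h1 k (by omega)]

/-- the `k`-th weight of a pattern -/
def wt (g : ℕ → ℕ → ℕ) (k : ℕ) : ℕ := ∑ i ∈ Finset.range (k + 1), (g (k + 1) i - g k i)

noncomputable def Spol {R : Type*} [CommRing R] (x : ℕ → R) (l : ℕ) (lam : ℕ → ℕ) : R :=
  ∑ g ∈ GT l lam, ∏ k ∈ Finset.range l, x k ^ wt g k

theorem Spol_succ {R : Type*} [CommRing R] (x : ℕ → R) (l : ℕ) (lam : ℕ → ℕ) :
    Spol x (l + 1) lam = ∑ μ ∈ interl l lam,
      x l ^ (∑ i ∈ Finset.range (l + 1), (lam i - μ i)) * Spol x l μ := by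
  classical
  rw [Spol, GT, Finset.sum_image]
  · rw [Finset.sum_sigma]
    refine Finset.sum_congr rfl fun μ hμ => ?_
    rw [Spol, Finset.mul_sum]
    refine Finset.sum_congr rfl fun g hg => ?_
    rw [mem_GT] at hg
    rw [Finset.prod_range_succ, mul_comm]
    congr 1
    · simp [wt, hg.1 l le_rfl]
    · refine Finset.prod_congr rfl fun k hk => ?_
      rw [Finset.mem_range] at hk
      simp [wt, show k ≤ l by omega, show k + 1 ≤ l by omega]
  · rintro ⟨μ, g⟩ h ⟨μ', g'⟩ h' he
    simp only [Finset.coe_sigma, Set.mem_sigma_iff, Finset.mem_coe, mem_GT] at h h'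
    have e1 : g = g' := by
      have : ∀ k ≤ l, g k = g' k := by
        intro k hk
        have := congrFun he k
        simpa [hk] using this
      funext k
      rcases Nat.lt_or_ge l k with hkl | hkl
      · rw [h.2.1 k hkl.le, h'.2.1 k hkl.le, ← h.2.1 l le_rfl, ← h'.2.1 l le_rfl, this l le_rfl]
      · exact this k hkl
    subst e1
    have : μ = μ' := by rw [← h.2.1 l le_rfl, ← h'.2.1 l le_rfl]
    subst this
    rfl

noncomputable def alt {R : Type*} [CommRing R] (x : ℕ → R) (l : ℕ) (u : ℕ → ℕ) : R :=
  Matrix.det (Matrix.of fun i j : Fin l => x i ^ (u j + (l - 1 - (j : ℕ))))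

theorem pow_sub_telescope {R : Type*} [CommRing R] (a b : R) (p q : ℕ) (c : ℕ) (h : q ≤ p) :
    a ^ (p + (c + 1)) - b ^ (p - q + 1) * a ^ (q + c) =
      (a - b) * ∑ s ∈ Finset.Icc q p, b ^ (p - s) * a ^ (s + c) := by
  obtain ⟨d, rfl⟩ := Nat.exists_eq_add_of_le h
  have h1 := (Commute.all a b).mul_geom_sum₂ (d + 1)
  have h2 : ∑ s ∈ Finset.Icc q (q + d), b ^ (q + d - s) * a ^ (s + c) =
      a ^ (q + c) * ∑ i ∈ Finset.range (d + 1), a ^ i * b ^ (d + 1 - 1 - i) := by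
    rw [Finset.mul_sum, ← Finset.Ico_add_one_right_eq_Icc, Finset.sum_Ico_eq_sum_range]
    rw [show q + d + 1 - q = d + 1 by omega]
    refine Finset.sum_congr rfl fun i hi => ?_
    rw [Finset.mem_range] at hi
    rw [show q + d - (q + i) = d + 1 - 1 - i by omega]
    ring
  rw [h2, mul_left_comm, h1, show q + d - q + 1 = d + 1 by omega]
  ring

theorem alt_succ {R : Type*} [CommRing R] (x : ℕ → R) (l : ℕ) (lam : ℕ → ℕ)
    (hlam : ∀ i < l, lam (i + 1) ≤ lam i) :
    alt x (l + 1) lam = (∏ i ∈ Finset.range l, (x i - x l)) * ∑ μ ∈ interl l lam,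
      x l ^ (∑ i ∈ Finset.range (l + 1), (lam i - μ i)) * alt x l μ := by
  classical
  -- column operations, performed as multiplication from the transposed side
  let M : Matrix (Fin (l + 1)) (Fin (l + 1)) R :=
    Matrix.of fun i j => x i ^ (lam j + (l + 1 - 1 - (j : ℕ)))
  let N : Matrix (Fin (l + 1)) (Fin (l + 1)) R :=
    Matrix.of fun i j => if h : (j : ℕ) < l then
      M i j - x l ^ (lam j - lam (j + 1) + 1) * M i ⟨j + 1, by omega⟩ else M i j
  have hMN : M.det = N.det := by
    let U : Matrix (Fin (l + 1)) (Fin (l + 1)) R :=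
      Matrix.of fun i j => if i = j then 1 else
        if (i : ℕ) = j + 1 then - x l ^ (lam j - lam (j + 1) + 1) else 0
    have hU : U.det = 1 := by
      rw [Matrix.det_of_isLowerTriangular]
      · simp [U]
      · intro i j hij
        have : (i : ℕ) < j := hij
        simp only [U, Matrix.of_apply]
        rw [if_neg (by omega), if_neg (by omega)]
    have : N = M * U := by
      ext i j
      rw [Matrix.mul_apply]
      by_cases hj : (j : ℕ) < l
      · have hne : j ≠ (⟨j + 1, by omega⟩ : Fin (l + 1)) := by
          intro h
          have := congrArg Fin.val h
          simp at this
        rw [← Finset.sum_subset (Finset.subset_univ {j, (⟨j + 1, by omega⟩ : Fin (l + 1))}),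
          Finset.sum_pair hne]
        · simp only [N, U, Matrix.of_apply, dif_pos hj, if_true]
          rw [if_neg hne.symm]
          ring
        · intro k _ hk
          simp only [Finset.mem_insert, Finset.mem_singleton, not_or, Fin.ext_iff] at hk
          simp only [U, Matrix.of_apply]
          rw [if_neg (by rw [Fin.ext_iff]; exact hk.1), if_neg hk.2, mul_zero]
      · rw [Finset.sum_eq_single j]
        · simp only [N, U, Matrix.of_apply, dif_neg hj, if_true, mul_one]
        · intro k _ hk
          simp only [U, Matrix.of_apply]
          have := k.2
          rw [if_neg hk, if_neg (by omega), mul_zero]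
        · simp
    rw [this, Matrix.det_mul, hU, mul_one]
  have hlast : ∀ j : Fin (l + 1), j ≠ Fin.last l → N (Fin.last l) j = 0 := by
    intro j hj
    have hj' : (j : ℕ) < l := by
      have := j.2
      have : (j : ℕ) ≠ l := fun h => hj (Fin.ext h)
      omega
    have := hlam j hj'
    simp only [N, M, Matrix.of_apply, dif_pos hj', Fin.val_last]
    rw [← pow_add, sub_eq_zero]
    congr 1
    omega
  have hexp : N.det = x l ^ lam l *
      (N.submatrix (Fin.castSucc) (Fin.castSucc)).det := by
    rw [Matrix.det_succ_row _ (Fin.last l), Finset.sum_eq_single (Fin.last l)]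
    · have : N (Fin.last l) (Fin.last l) = x l ^ lam l := by
        simp [N, M]
      rw [this]
      simp [Fin.succAbove_last, ← two_mul]
    · intro j _ hj
      rw [hlast j hj]
      ring
    · simp
  have hsub : N.submatrix (Fin.castSucc) (Fin.castSucc) =
      Matrix.of fun i j : Fin l => (x i - x l) *
        ∑ s ∈ Finset.Icc (lam (j + 1)) (lam j), x l ^ (lam j - s) * x i ^ (s + (l - 1 - (j : ℕ))) := by
    ext i j
    have hj := j.2
    simp only [Matrix.submatrix_apply, N, M, Matrix.of_apply, Fin.val_castSucc, dif_pos hj]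
    rw [← pow_sub_telescope _ _ _ _ _ (hlam j hj)]
    congr 3 <;> omega
  have hdet : (Matrix.of fun i j : Fin l =>
        ∑ s ∈ Finset.Icc (lam (j + 1)) (lam j), x l ^ (lam j - s) * x i ^ (s + (l - 1 - (j : ℕ)))).det
      = ∑ r ∈ Fintype.piFinset (fun j : Fin l => Finset.Icc (lam (j + 1)) (lam j)),
        (∏ j : Fin l, x l ^ (lam j - r j)) *
        (Matrix.of fun i j : Fin l => x i ^ (r j + (l - 1 - (j : ℕ)))).det := by
    rw [← Matrix.det_transpose]
    have := (Matrix.detRowAlternating (R := R) (n := Fin l)).toMultilinearMap.map_sum_finset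
      (fun (j : Fin l) (s : ℕ) => (fun i : Fin l => x l ^ (lam j - s) * x i ^ (s + (l - 1 - (j : ℕ)))))
      (fun j : Fin l => Finset.Icc (lam (j + 1)) (lam j))
    have e : (Matrix.of fun i j : Fin l =>
        ∑ s ∈ Finset.Icc (lam (j + 1)) (lam j), x l ^ (lam j - s) * x i ^ (s + (l - 1 - (j : ℕ)))).transpose
        = fun (j : Fin l) => ∑ s ∈ Finset.Icc (lam (j + 1)) (lam j),
          (fun i : Fin l => x l ^ (lam j - s) * x i ^ (s + (l - 1 - (j : ℕ)))) := by
      ext j i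
      simp [Matrix.transpose_apply, Finset.sum_apply]
    rw [e]
    refine this.trans ?_
    refine Finset.sum_congr rfl fun r _ => ?_
    have h2 := Matrix.det_mul_column (fun j : Fin l => x l ^ (lam j - r j))
      (Matrix.of fun j i : Fin l => x i ^ (r j + (l - 1 - (j : ℕ))))
    rw [← Matrix.det_transpose (Matrix.of fun i j : Fin l => x i ^ (r j + (l - 1 - (j : ℕ))))]
    exact h2
  have hrow := Matrix.det_mul_column (fun i : Fin l => x i - x l) (Matrix.of fun i j : Fin l =>
        ∑ s ∈ Finset.Icc (lam (j + 1)) (lam j), x l ^ (lam j - s) * x i ^ (s + (l - 1 - (j : ℕ))))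
  change M.det = _
  rw [hMN, hexp, hsub]
  have hrow' : (Matrix.of fun i j : Fin l => (x i - x l) *
        ∑ s ∈ Finset.Icc (lam (j + 1)) (lam j), x l ^ (lam j - s) * x i ^ (s + (l - 1 - (j : ℕ)))).det
      = _ := hrow
  rw [hrow', hdet, Finset.prod_range, mul_left_comm]
  congr 1
  rw [interl, Finset.sum_map, Finset.mul_sum]
  refine Finset.sum_congr rfl fun r _ => ?_
  simp only [Function.Embedding.coeFn_mk, alt]
  rw [← mul_assoc, Finset.prod_pow_eq_pow_sum, ← pow_add, Finset.sum_range_succ, Finset.sum_range]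
  simp [extz, add_comm]

theorem interl_anti {l : ℕ} {lam μ : ℕ → ℕ} (h : μ ∈ interl (l + 1) lam) :
    ∀ i < l, μ (i + 1) ≤ μ i := by
  rw [mem_interl] at h
  intro i hi
  exact (h.1 (i + 1) (by omega)).2.trans (h.1 i (by omega)).1

theorem interl_zero (l : ℕ) : interl l (fun _ => 0) = {fun _ => 0} := by
  ext μ
  rw [mem_interl, Finset.mem_singleton]
  constructor
  · rintro ⟨h1, h2⟩
    funext i
    rcases Nat.lt_or_ge i l with h | h
    · have := (h1 i h).2
      omega
    · exact h2 i h
  · rintro rfl; simp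

theorem alt_eq_Spol {R : Type*} [CommRing R] (x : ℕ → R) (l : ℕ) (lam : ℕ → ℕ)
    (hlam : ∀ i, i + 1 < l → lam (i + 1) ≤ lam i) (h0 : ∀ i, l ≤ i → lam i = 0) :
    alt x l lam = alt x l (fun _ => 0) * Spol x l lam := by
  induction l generalizing lam with
  | zero => simp [alt, Spol, GT]
  | succ l ih =>
    rw [alt_succ x l lam (fun i hi => hlam i (by omega)), alt_succ x l (fun _ => 0) (by simp),
      interl_zero, Spol_succ, Finset.sum_singleton]
    simp only [Nat.sub_self, Finset.sum_const_zero, pow_zero, one_mul]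
    rw [mul_assoc]
    congr 1
    rw [Finset.mul_sum]
    refine Finset.sum_congr rfl fun μ hμ => ?_
    rw [ih μ, mul_left_comm]
    · intro i hi
      rw [mem_interl] at hμ
      exact (hμ.1 (i + 1) (by omega)).2.trans (hμ.1 i (by omega)).1
    · rw [mem_interl] at hμ
      exact hμ.2

/-! ### Part 3: schur polynomials as sums over patterns -/

noncomputable def xv (l : ℕ) : ℕ → MvPolynomial (Fin l) ℤ := fun k => if h : k < l then X ⟨k, h⟩ else 0

theorem alt_xv (l : ℕ) (u : ℕ → ℕ) :
    alt (xv l) l u = altv l (fun j => u j + (l - 1 - (j : ℕ))) := by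
  simp [alt, altv, xv]

theorem vdm_ne_zero (l : ℕ) : vdm l ≠ 0 := by
  have h : vdm l = (Matrix.vandermonde (X : Fin l → MvPolynomial (Fin l) ℤ)).det *
      ((Equiv.Perm.sign (Fin.revPerm : Equiv.Perm (Fin l)) : ℤ) : MvPolynomial (Fin l) ℤ) := by
    rw [mul_comm, ← Matrix.det_permute']
    rw [vdm]
    congr 1
    ext1 i j
    simp only [Matrix.of_apply, Matrix.submatrix_apply, Matrix.vandermonde_apply, id, Fin.revPerm_apply,
      Fin.val_rev]
    congr 1
    omega
  rw [h]
  refine mul_ne_zero ?_ ?_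
  · rw [Matrix.det_vandermonde_ne_zero_iff]
    exact MvPolynomial.X_injective
  · rcases Int.units_eq_one_or (Equiv.Perm.sign (Fin.revPerm : Equiv.Perm (Fin l))) with h | h <;>
      simp [h]

theorem schur_eq_Spol (l : ℕ) (H : Fin l → ℕ) (hH : Antitone H) :
    schur l H = Spol (xv l) l (extz l H) := by
  have h1 := schur_mul_vdm l H
  have h2 := alt_eq_Spol (xv l) l (extz l H) (by
    intro i hi
    have : i < l := by omega
    simp only [extz, dif_pos hi, dif_pos this]
    apply hH
    simp) (by intro i hi; simp [extz, hi])
  rw [alt_xv, alt_xv] at h2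
  have h3 : altv l (fun j => 0 + (l - 1 - (j : ℕ))) = vdm l := by simp [altv, vdm]
  have h4 : (fun j : Fin l => extz l H j + (l - 1 - (j : ℕ))) = fun j => H j + (l - 1 - (j : ℕ)) := by
    funext j; simp [extz]
  rw [h3, h4, ← h1, mul_comm] at h2
  exact mul_left_cancel₀ (vdm_ne_zero l) h2

theorem rename_schur (l : ℕ) (H : Fin l → ℕ) (σ : Equiv.Perm (Fin l)) :
    rename σ (schur l H) = schur l H := by
  rw [schur, AlgHom.map_det]
  congr 1
  ext1 i j
  simp only [AlgHom.mapMatrix_apply, Matrix.map_apply, Matrix.of_apply, hp]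
  split_ifs
  · exact hsymm_isSymmetric _ _ _ σ
  · simp

/-- signed indicator that `v` is a rearrangement of `u` -/
noncomputable def eps (l : ℕ) (u v : Fin l → ℕ) : ℤ :=
  ∑ σ : Equiv.Perm (Fin l), (Equiv.Perm.sign σ : ℤ) * if v = u ∘ σ then 1 else 0

theorem monomial_prod (l : ℕ) (w : ℕ → ℕ) :
    ∏ k ∈ Finset.range l, xv l k ^ w k =
      monomial (Finsupp.equivFunOnFinite.symm fun i : Fin l => w i) 1 := by
  rw [Finset.prod_range, monomial_eq]
  simp [xv, Finsupp.prod_fintype]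

theorem coeff_schur_mul (l : ℕ) (H : Fin l → ℕ) (hH : Antitone H) (u v : Fin l → ℕ) :
    coeff (Finsupp.equivFunOnFinite.symm u) (schur l H * altv l v) =
      ∑ g ∈ GT l (extz l H), eps l u (fun i => wt g i + v i) := by
  have h1 : altv l v = ∑ σ : Equiv.Perm (Fin l), (C (Equiv.Perm.sign σ : ℤ)) *
      rename σ (monomial (Finsupp.equivFunOnFinite.symm v) (1 : ℤ)) := by
    rw [altv, Matrix.det_apply']
    refine Finset.sum_congr rfl fun σ _ => ?_
    rw [monomial_eq]
    simp [Finsupp.prod_fintype]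
  rw [h1, Finset.mul_sum, coeff_sum]
  have h2 : ∀ σ : Equiv.Perm (Fin l),
      coeff (Finsupp.equivFunOnFinite.symm u) (schur l H * (C (Equiv.Perm.sign σ : ℤ) *
        rename σ (monomial (Finsupp.equivFunOnFinite.symm v) (1 : ℤ)))) =
      (Equiv.Perm.sign σ : ℤ) * ∑ g ∈ GT l (extz l H),
        if (fun i : Fin l => wt g i + v i) = u ∘ σ then 1 else 0 := by
    intro σ
    rw [mul_left_comm, coeff_C_mul]
    congr 1
    conv_lhs => rw [← rename_schur l H σ, ← map_mul]
    have e : (Finsupp.equivFunOnFinite.symm u : Fin l →₀ ℕ) =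
        (Finsupp.equivFunOnFinite.symm (u ∘ σ)).mapDomain σ := by
      ext i
      obtain ⟨j, rfl⟩ := σ.surjective i
      rw [Finsupp.mapDomain_apply σ.injective]
      simp
    rw [e, coeff_rename_mapDomain _ σ.injective, schur_eq_Spol l H hH, Spol, Finset.sum_mul, coeff_sum]
    refine Finset.sum_congr rfl fun g _ => ?_
    rw [monomial_prod, monomial_mul, coeff_monomial, mul_one]
    congr 1
    rw [← Finsupp.equivFunOnFinite.symm.injective.eq_iff]
    apply propext
    constructor <;> intro h <;> rw [← h] <;> ext i <;> simp
  simp only [h2, eps]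
  rw [Finset.sum_comm]
  simp only [Finset.mul_sum]

theorem eps_swap (l : ℕ) (u v : Fin l → ℕ) (a b : Fin l) (hab : a ≠ b) :
    eps l u (v ∘ Equiv.swap a b) = - eps l u v := by
  rw [eps, eps, ← Finset.sum_neg_distrib, ← Equiv.sum_comp (Equiv.mulRight (Equiv.swap a b))]
  refine Finset.sum_congr rfl fun σ _ => ?_
  have : (v ∘ Equiv.swap a b = u ∘ (σ * Equiv.swap a b)) ↔ v = u ∘ σ := by
    rw [Equiv.Perm.coe_mul, ← Function.comp_assoc]
    exact (Equiv.swap a b).surjective.injective_comp_right.eq_iff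
  simp only [Equiv.coe_mulRight, this, Equiv.Perm.sign_mul, Equiv.Perm.sign_swap hab]
  split_ifs <;> simp

theorem eps_strict (l : ℕ) (u v : Fin l → ℕ) (hu : StrictAnti u) (hv : StrictAnti v) :
    eps l u v = if v = u then 1 else 0 := by
  rw [eps, Finset.sum_eq_single 1]
  · simp
  · intro σ _ hσ
    rw [if_neg, mul_zero]
    intro h
    apply hσ
    have hmono : StrictMono σ := by
      intro a b hab
      have := hv hab
      rw [h] at this
      exact hu.lt_iff_gt.1 this
    ext i
    have := Subsingleton.elim (hmono.orderIsoOfSurjective σ σ.surjective) (OrderIso.refl _)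
    have := congrArg (fun e => (e i : ℕ)) this
    simpa using this
  · simp

/-! ### Part 4: the sign-reversing involution -/

def IsGT (l : ℕ) (lam : ℕ → ℕ) (g : ℕ → ℕ → ℕ) : Prop :=
  (∀ k, l ≤ k → g k = lam) ∧ (∀ k ≤ l, ∀ i, k ≤ i → g k i = 0) ∧
    ∀ k < l, ∀ i, g (k + 1) (i + 1) ≤ g k i ∧ g k i ≤ g (k + 1) i

theorem mem_GT_iff {l : ℕ} {lam : ℕ → ℕ} {g : ℕ → ℕ → ℕ} (h0 : ∀ i, l ≤ i → lam i = 0) :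
    g ∈ GT l lam ↔ IsGT l lam g := by
  rw [mem_GT, IsGT]
  simp only [mem_interl]
  constructor
  · rintro ⟨h1, h2⟩
    have hz : ∀ k ≤ l, ∀ i, k ≤ i → g k i = 0 := by
      intro k hk i hi
      rcases Nat.lt_or_ge k l with h | h
      · exact (h2 k h).2 i hi
      · rw [h1 k h]; exact h0 i (by omega)
    refine ⟨h1, hz, fun k hk i => ?_⟩
    rcases Nat.lt_or_ge i k with h | h
    · exact (h2 k hk).1 i h
    · rw [hz (k + 1) hk (i + 1) (by omega), hz k hk.le i h]
      simp
  · rintro ⟨h1, h2, h3⟩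
    exact ⟨h1, fun k hk => ⟨fun i _ => h3 k hk i, fun i hi => h2 k hk.le i hi⟩⟩

def Rs (g : ℕ → ℕ → ℕ) (k N : ℕ) : ℤ := ∑ j ∈ Finset.range N, (g k j : ℤ)

theorem Rs_succ (g : ℕ → ℕ → ℕ) (k N : ℕ) : Rs g k (N + 1) = Rs g k N + g k N := by
  simp [Rs, Finset.sum_range_succ]

theorem Rs_zero (g : ℕ → ℕ → ℕ) (k : ℕ) : Rs g k 0 = 0 := by
  simp [Rs]

def tval (P : ℕ → ℕ) (g : ℕ → ℕ → ℕ) (i k : ℕ) : ℤ :=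
  P (k + 1) + Rs g (k + 2) (i + 1) - Rs g (k + 1) (i + 1) - P k - Rs g (k + 1) i + Rs g k i

def selp (l : ℕ) (P : ℕ → ℕ) (g : ℕ → ℕ → ℕ) (i k : ℕ) : Prop :=
  k + 1 < l ∧ 0 < tval P g i k ∧ (∀ i' < i, ∀ k', k' + 1 < l → tval P g i' k' ≤ 0) ∧
    ∀ k', k < k' → k' + 1 < l → tval P g i k' ≤ 0

def newrow (P : ℕ → ℕ) (g : ℕ → ℕ → ℕ) (i k : ℕ) : ℕ → ℕ := fun j =>
  if j < i then g (k + 1) j else if j = i then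
    (tval P g i k - 1 + max (g (k + 2) (i + 1)) (g k i)).toNat
  else min (g (k + 2) j) (g k (j - 1)) + max (g (k + 2) (j + 1)) (g k j) - g (k + 1) j

def tog (P : ℕ → ℕ) (g : ℕ → ℕ → ℕ) (i k : ℕ) : ℕ → ℕ → ℕ :=
  Function.update g (k + 1) (newrow P g i k)

theorem tval_step {l : ℕ} {lam : ℕ → ℕ} {P : ℕ → ℕ} {g : ℕ → ℕ → ℕ} (hg : IsGT l lam g)
    {i k : ℕ} (hk : k + 1 < l) (hi : k ≤ i) (h : 0 < tval P g (i + 1) k) : 0 < tval P g i k := by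
  obtain ⟨h1, h2, h3⟩ := hg
  simp only [tval, Rs_succ] at h ⊢
  have a1 := (h3 (k + 1) hk i).1
  have a2 := h2 (k + 1) hk.le (i + 1) (by omega)
  have a3 := h2 k (by omega) i hi
  simp only [add_assoc, Nat.reduceAdd] at a1
  omega

theorem sel_le {l : ℕ} {lam : ℕ → ℕ} {P : ℕ → ℕ} {g : ℕ → ℕ → ℕ} (hg : IsGT l lam g)
    {i k : ℕ} (h : selp l P g i k) : i ≤ k := by
  by_contra hlt
  obtain ⟨h1, h2, h3, h4⟩ := h
  obtain ⟨j, rfl⟩ : ∃ j, i = j + 1 := ⟨i - 1, by omega⟩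
  have := tval_step hg h1 (by omega : k ≤ j) h2
  have := h3 j (by omega) k h1
  omega

theorem sel_bound {l : ℕ} {lam : ℕ → ℕ} {P : ℕ → ℕ} (hP : ∀ k, k + 1 < l → P (k + 1) ≤ P k)
    {g : ℕ → ℕ → ℕ} (hg : IsGT l lam g)
    {i k : ℕ} (h : selp l P g i k) : tval P g i k + g (k + 1) i ≤ g (k + 2) i ∧
      (0 < i → tval P g i k + g (k + 1) i ≤ g k (i - 1)) := by
  obtain ⟨h1, h2, h3, h4⟩ := h
  obtain ⟨g1, g2, g3⟩ := hg
  have hPk := hP k h1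
  rcases i with _ | i
  · simp only [tval, Rs_succ, Rs_zero]
    refine ⟨by omega, by omega⟩
  · have h5 := h3 i (by omega) k h1
    have a1 := (g3 (k + 1) h1 i).1
    have a2 := (g3 k (by omega) i).2
    simp only [tval, Rs_succ, add_assoc, Nat.reduceAdd, Nat.add_sub_cancel] at *
    refine ⟨by omega, fun _ => by omega⟩

theorem tog_of_ne {P : ℕ → ℕ} {g : ℕ → ℕ → ℕ} {i k k' : ℕ} (h : k' ≠ k + 1) :
    tog P g i k k' = g k' := by
  simp [tog, h]

theorem tog_same {P : ℕ → ℕ} {g : ℕ → ℕ → ℕ} {i k : ℕ} :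
    tog P g i k (k + 1) = newrow P g i k := by
  simp [tog]

theorem tog_IsGT {l : ℕ} {lam : ℕ → ℕ} {P : ℕ → ℕ} (hP : ∀ k, k + 1 < l → P (k + 1) ≤ P k)
    {g : ℕ → ℕ → ℕ} (hg : IsGT l lam g)
    {i k : ℕ} (h : selp l P g i k) : IsGT l lam (tog P g i k) := by
  have hik := sel_le hg h
  obtain ⟨b1, b2⟩ := sel_bound hP hg h
  obtain ⟨h1, h2, h3, h4⟩ := h
  obtain ⟨g1, g2, g3⟩ := hg
  have c1 : ∀ j, g (k + 2) (j + 1) ≤ g (k + 1) j ∧ g (k + 1) j ≤ g (k + 2) j := g3 (k + 1) h1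
  have c2 : ∀ j, g (k + 1) (j + 1) ≤ g k j ∧ g k j ≤ g (k + 1) j := g3 k (by omega)
  refine ⟨?_, ?_, ?_⟩
  · intro k' hk'
    rw [tog_of_ne (by omega), g1 k' hk']
  · intro k' hk' j hj
    by_cases hkk : k' = k + 1
    · subst hkk
      rw [tog_same, newrow, if_neg (by omega), if_neg (by omega)]
      have e1 := g2 k (by omega) (j - 1) (by omega)
      have e2 := g2 (k + 2) (by omega) (j + 1) (by omega)
      have e3 := g2 k (by omega) j (by omega)
      omega
    · rw [tog_of_ne hkk]
      exact g2 k' hk' j hj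
  · intro k' hk' j
    by_cases hkk : k' = k + 1
    · subst hkk
      rw [tog_same, tog_of_ne (by omega)]
      change g (k + 2) (j + 1) ≤ _ ∧ _ ≤ g (k + 2) j
      have q1 := c1 j
      have q2 := c2 j
      rw [newrow]
      split_ifs with hj1 hj2
      · exact q1
      · subst hj2
        omega
      · have q3 := c2 (j - 1)
        rw [show j - 1 + 1 = j by omega] at q3
        omega
    · by_cases hkk2 : k' = k
      · subst hkk2
        rw [tog_same, tog_of_ne (by omega)]
        have q1 := c1 j
        have q2 := c2 j
        have q3 := c1 (j + 1)
        have q4 := c2 (j + 1)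
        simp only [newrow, Nat.add_sub_cancel]
        constructor
        · split_ifs with hj1 hj2
          · omega
          · subst hj2
            have := b2 (by omega)
            simp only [Nat.add_sub_cancel] at this
            omega
          · omega
        · split_ifs with hj1 hj2
          · omega
          · subst hj2
            omega
          · have q5 := c2 (j - 1)
            rw [show j - 1 + 1 = j by omega] at q5
            omega
      · rw [tog_of_ne hkk, tog_of_ne (by omega)]
        exact g3 k' hk' j

theorem Rs_tog_of_ne {P : ℕ → ℕ} {g : ℕ → ℕ → ℕ} {i k k' N : ℕ} (h : k' ≠ k + 1) :
    Rs (tog P g i k) k' N = Rs g k' N := by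
  simp only [Rs, tog_of_ne h]

theorem Rs_tog_of_le {P : ℕ → ℕ} {g : ℕ → ℕ → ℕ} {i k k' N : ℕ} (h : N ≤ i) :
    Rs (tog P g i k) k' N = Rs g k' N := by
  by_cases hk : k' = k + 1
  · subst hk
    refine Finset.sum_congr rfl fun j hj => ?_
    rw [Finset.mem_range] at hj
    rw [tog_same, newrow, if_pos (by omega)]
  · exact Rs_tog_of_ne hk

theorem tval_tog {P : ℕ → ℕ} {g : ℕ → ℕ → ℕ} {i k : ℕ} (h : 0 < tval P g i k) :
    tval P (tog P g i k) i k = 1 + g (k + 1) i - max (g (k + 2) (i + 1)) (g k i) := by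
  have e : tval P (tog P g i k) i k = tval P g i k + g (k + 1) i - newrow P g i k i := by
    simp only [tval]
    rw [Rs_tog_of_ne (by omega : k + 2 ≠ k + 1), Rs_succ _ (k + 1) i, Rs_tog_of_le le_rfl,
      Rs_tog_of_le le_rfl, tog_same, Rs_succ g (k + 1) i]
    ring
  rw [e, newrow, if_neg (by omega), if_pos rfl]
  omega

theorem tog_sel {l : ℕ} {lam : ℕ → ℕ} {P : ℕ → ℕ}
    {g : ℕ → ℕ → ℕ} (hg : IsGT l lam g)
    {i k : ℕ} (h : selp l P g i k) : selp l P (tog P g i k) i k := by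
  obtain ⟨h1, h2, h3, h4⟩ := h
  obtain ⟨g1, g2, g3⟩ := hg
  refine ⟨h1, ?_, ?_, ?_⟩
  · rw [tval_tog h2]
    have q1 : g (k + 2) (i + 1) ≤ g (k + 1) i := (g3 (k + 1) h1 i).1
    have q2 := (g3 k (by omega) i).2
    omega
  · intro i' hi' k' hk'
    have := h3 i' hi' k' hk'
    simp only [tval] at this ⊢
    rw [Rs_tog_of_le (by omega), Rs_tog_of_le (by omega), Rs_tog_of_le (by omega), Rs_tog_of_le (by omega)]
    exact this
  · intro k' hk hk'
    have := h4 k' hk hk'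
    simp only [tval] at this ⊢
    rw [Rs_tog_of_ne (by omega), Rs_tog_of_ne (by omega), Rs_tog_of_le (by omega), Rs_tog_of_le (by omega)]
    exact this

theorem tog_tog {l : ℕ} {lam : ℕ → ℕ} {P : ℕ → ℕ}
    {g : ℕ → ℕ → ℕ} (hg : IsGT l lam g)
    {i k : ℕ} (h : selp l P g i k) : tog P (tog P g i k) i k = g := by
  obtain ⟨h1, h2, h3, h4⟩ := h
  obtain ⟨g1, g2, g3⟩ := hg
  funext k' j
  by_cases hk : k' = k + 1
  · subst hk
    have q1 : g (k + 2) (j + 1) ≤ g (k + 1) j ∧ g (k + 1) j ≤ g (k + 2) j := g3 (k + 1) h1 j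
    have q2 := g3 k (by omega) j
    rw [tog_same, newrow, tval_tog h2, tog_of_ne (by omega : k + 2 ≠ k + 1),
      tog_of_ne (by omega : k ≠ k + 1), tog_same, newrow]
    split_ifs with hj1 hj2
    · rfl
    · subst hj2
      omega
    · have q5 := g3 k (by omega) (j - 1)
      rw [show j - 1 + 1 = j by omega] at q5
      omega
  · rw [tog_of_ne hk, tog_of_ne hk]

theorem wt_eq {l : ℕ} {lam : ℕ → ℕ} {g : ℕ → ℕ → ℕ} (hg : IsGT l lam g) {k : ℕ} (hk : k < l) (N : ℕ)
    (hN : k < N) : (wt g k : ℤ) = Rs g (k + 1) N - Rs g k N := by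
  obtain ⟨g1, g2, g3⟩ := hg
  have h1 : (wt g k : ℤ) = Rs g (k + 1) (k + 1) - Rs g k (k + 1) := by
    rw [wt, Rs, Rs, ← Finset.sum_sub_distrib]
    push_cast
    refine Finset.sum_congr rfl fun i _ => ?_
    have := (g3 k hk i).2
    omega
  rw [h1]
  induction N, hN using Nat.le_induction with
  | base => rfl
  | succ N hN ih =>
    rw [Rs_succ g (k + 1) N, Rs_succ g k N, g2 (k + 1) (by omega) N hN, g2 k (by omega) N (by omega)]
    simpa using ih

theorem Rs_tog_sum {l : ℕ} {lam : ℕ → ℕ} {P : ℕ → ℕ}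
    {g : ℕ → ℕ → ℕ} (hg : IsGT l lam g)
    {i k : ℕ} (h : selp l P g i k) (M : ℕ) (hM : i ≤ M) :
    Rs (tog P g i k) (k + 1) (M + 1) = (P (k + 1) : ℤ) - P k - 1 + Rs g (k + 2) (M + 1)
      - Rs g (k + 1) (M + 1) + Rs g k M + max (g (k + 2) (M + 1)) (g k M) := by
  obtain ⟨h1, h2, h3, h4⟩ := h
  obtain ⟨g1, g2, g3⟩ := hg
  induction M, hM using Nat.le_induction with
  | base =>
    rw [Rs_succ _ (k + 1) i, Rs_tog_of_le le_rfl, tog_same, newrow, if_neg (by omega), if_pos rfl]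
    rw [Int.toNat_of_nonneg (by omega)]
    simp only [tval]
    ring
  | succ M hM ih =>
    rw [Rs_succ _ (k + 1) (M + 1), ih, tog_same, newrow, if_neg (by omega), if_neg (by omega)]
    have q1 : g (k + 2) (M + 1 + 1) ≤ g (k + 1) (M + 1) ∧ g (k + 1) (M + 1) ≤ g (k + 2) (M + 1) :=
      g3 (k + 1) h1 (M + 1)
    have q2 := g3 k (by omega) M
    have q3 := g3 k (by omega) (M + 1)
    rw [Rs_succ g (k + 2) (M + 1), Rs_succ g (k + 1) (M + 1), Rs_succ g k M]
    simp only [Nat.add_sub_cancel]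
    omega

theorem wt_tog {l : ℕ} {lam : ℕ → ℕ} {P : ℕ → ℕ} (hP : ∀ k, k + 1 < l → P (k + 1) ≤ P k)
    {g : ℕ → ℕ → ℕ} (hg : IsGT l lam g)
    {i k : ℕ} (h : selp l P g i k) :
    (P k : ℤ) + wt (tog P g i k) k + 1 = P (k + 1) + wt g (k + 1) ∧
    (P (k + 1) : ℤ) + wt (tog P g i k) (k + 1) = P k + wt g k + 1 ∧
    ∀ k', k' < l → k' ≠ k → k' ≠ k + 1 → wt (tog P g i k) k' = wt g k' := by
  have hg' := tog_IsGT hP hg h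
  have hik := sel_le hg h
  have hs := Rs_tog_sum hg h (k + 1) (by omega)
  obtain ⟨h1, h2, h3, h4⟩ := h
  have w1 := wt_eq hg (by omega : k < l) (k + 2) (by omega)
  have w2 := wt_eq hg h1 (k + 2) (by omega)
  have w3 := wt_eq hg' (by omega : k < l) (k + 2) (by omega)
  have w4 := wt_eq hg' h1 (k + 2) (by omega)
  rw [Rs_tog_of_ne (by omega : k ≠ k + 1)] at w3
  rw [Rs_tog_of_ne (by omega : k + 1 + 1 ≠ k + 1)] at w4
  obtain ⟨g1, g2, g3⟩ := hg
  have z1 := g2 (k + 2) (by omega) (k + 2) le_rfl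
  have z2 := g2 k (by omega) (k + 1) (by omega)
  have z3 : Rs g k (k + 2) = Rs g k (k + 1) + g k (k + 1) := Rs_succ g k (k + 1)
  simp only [add_assoc, Nat.reduceAdd] at *
  refine ⟨by omega, by omega, ?_⟩
  intro k' _ hk1 hk2
  rw [wt, wt, tog_of_ne (by omega), tog_of_ne (by omega)]

theorem sel_unique {l : ℕ} {P : ℕ → ℕ} {g : ℕ → ℕ → ℕ} {i k i' k' : ℕ}
    (h : selp l P g i k) (h' : selp l P g i' k') : i = i' ∧ k = k' := by
  obtain ⟨h1, h2, h3, h4⟩ := h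
  obtain ⟨f1, f2, f3, f4⟩ := h'
  have : i = i' := by
    rcases Nat.lt_trichotomy i i' with hh | hh | hh
    · have := f3 i hh k h1; omega
    · exact hh
    · have := h3 i' hh k' f1; omega
  subst this
  refine ⟨rfl, ?_⟩
  rcases Nat.lt_trichotomy k k' with hh | hh | hh
  · have := h4 k' hh f1; omega
  · exact hh
  · have := f4 k hh h1; omega

theorem sel_exists {l : ℕ} {P : ℕ → ℕ} {g : ℕ → ℕ → ℕ} (h : ∃ i k, k + 1 < l ∧ 0 < tval P g i k) :
    ∃ i k, selp l P g i k := by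
  classical
  have hs := Nat.find_spec h
  have hm := fun i' (hi' : i' < Nat.find h) => Nat.find_min h hi'
  set i := Nat.find h with hi
  obtain ⟨k, hk⟩ := hs
  have hspec := Nat.findGreatest_spec (P := fun k => k + 1 < l ∧ 0 < tval P g i k) (n := l)
    (m := k) (by omega) hk
  refine ⟨i, Nat.findGreatest (fun k => k + 1 < l ∧ 0 < tval P g i k) l, hspec.1, hspec.2, ?_, ?_⟩
  · intro i' hi' k' hk'
    by_contra hc
    exact hm i' hi' ⟨k', hk', by omega⟩
  · intro k' hlt hk'
    by_contra hc
    exact Nat.findGreatest_is_greatest hlt (by omega) ⟨hk', by omega⟩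

theorem sum_pos_of_good (l : ℕ) (lam : ℕ → ℕ) (h0 : ∀ i, l ≤ i → lam i = 0)
    (P : ℕ → ℕ) (hP : ∀ k, k + 1 < l → P (k + 1) ≤ P k) (u : Fin l → ℕ) (hu : StrictAnti u)
    (g₀ : ℕ → ℕ → ℕ) (hg₀ : IsGT l lam g₀) (hgood : ∀ i k, k + 1 < l → tval P g₀ i k ≤ 0)
    (hwt : ∀ i : Fin l, wt g₀ i + (P i + (l - 1 - (i : ℕ))) = u i) :
    0 < ∑ g ∈ GT l lam, eps l u (fun i : Fin l => wt g i + (P i + (l - 1 - (i : ℕ)))) := by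
  classical
  let F : (ℕ → ℕ → ℕ) → ℤ := fun g => eps l u (fun i : Fin l => wt g i + (P i + (l - 1 - (i : ℕ))))
  rw [← Finset.sum_filter_add_sum_filter_not (GT l lam)
    (fun g => ∃ p : ℕ × ℕ, selp l P g p.1 p.2)]
  have hbad : ∑ g ∈ (GT l lam).filter (fun g => ∃ p : ℕ × ℕ, selp l P g p.1 p.2), F g = 0 := by
    have hT : ∀ g i k, IsGT l lam g → selp l P g i k → F (tog P g i k) = - F g := by
      intro g i k hg hs
      obtain ⟨w1, w2, w3⟩ := wt_tog hP hg hs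
      have hk := hs.1
      simp only [F]
      rw [← eps_swap l u _ (⟨k, by omega⟩ : Fin l) ⟨k + 1, hk⟩ (by simp)]
      congr 1
      funext j
      simp only [Function.comp]
      by_cases hj1 : j = ⟨k, by omega⟩
      · subst hj1
        rw [Equiv.swap_apply_left]
        simp only
        omega
      · by_cases hj2 : j = ⟨k + 1, hk⟩
        · subst hj2
          rw [Equiv.swap_apply_right]
          simp only
          omega
        · rw [Equiv.swap_apply_of_ne_of_ne hj1 hj2, w3 j j.2]
          · intro h; exact hj1 (Fin.ext h)
          · intro h; exact hj2 (Fin.ext h)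
    have hspec : ∀ g (hg : g ∈ (GT l lam).filter (fun g => ∃ p : ℕ × ℕ, selp l P g p.1 p.2)),
        ∃ p : ℕ × ℕ, selp l P g p.1 p.2 := fun g hg => (Finset.mem_filter.1 hg).2
    have hGT : ∀ g ∈ (GT l lam).filter (fun g => ∃ p : ℕ × ℕ, selp l P g p.1 p.2), IsGT l lam g :=
      fun g hg => (mem_GT_iff h0).1 (Finset.mem_filter.1 hg).1
    refine Finset.sum_involution
      (fun g hg => tog P g (hspec g hg).choose.1 (hspec g hg).choose.2) ?_ ?_ ?_ ?_
    · intro g hg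
      rw [hT g _ _ (hGT g hg) (hspec g hg).choose_spec]
      ring
    · intro g hg hne heq
      have := hT g _ _ (hGT g hg) (hspec g hg).choose_spec
      rw [heq] at this
      omega
    · intro g hg
      rw [Finset.mem_filter, mem_GT_iff h0]
      exact ⟨tog_IsGT hP (hGT g hg) (hspec g hg).choose_spec,
        (hspec g hg).choose, tog_sel (hGT g hg) (hspec g hg).choose_spec⟩
    · intro g hg
      have hs := (hspec g hg).choose_spec
      have hs' := tog_sel (hGT g hg) hs
      generalize_proofs q1 q2
      obtain ⟨e1, e2⟩ := sel_unique hs' q2.choose_spec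
      rw [← e1, ← e2]
      exact tog_tog (hGT g hg) hs
  change 0 < ∑ g ∈ (GT l lam).filter (fun g => ∃ p : ℕ × ℕ, selp l P g p.1 p.2), F g + _
  rw [hbad, zero_add]
  have hF : ∀ g ∈ (GT l lam).filter (fun g => ¬ ∃ p : ℕ × ℕ, selp l P g p.1 p.2),
      F g = if (fun i : Fin l => wt g i + (P i + (l - 1 - (i : ℕ)))) = u then 1 else 0 := by
    intro g hg
    rw [Finset.mem_filter, mem_GT_iff h0] at hg
    obtain ⟨hg, hn⟩ := hg
    refine eps_strict l u _ hu ?_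
    have hno : ∀ i k, k + 1 < l → tval P g i k ≤ 0 := by
      intro i k hk
      by_contra hc
      obtain ⟨i, k, h⟩ := sel_exists (l := l) (P := P) (g := g) ⟨i, k, hk, by omega⟩
      exact hn ⟨(i, k), h⟩
    obtain _ | l := l
    · intro a; exact a.elim0
    rw [Fin.strictAnti_iff_succ_lt]
    intro i
    have hi := i.2
    have h1 := hno (l + 1) i (by omega)
    have w1 := wt_eq hg (by omega : (i : ℕ) < l + 1) (l + 1) (by omega)
    have w2 := wt_eq hg (by omega : (i : ℕ) + 1 < l + 1) (l + 2) (by omega)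
    have g2 := hg.2.1 (i + 1) (by omega) (l + 1) (by omega)
    simp only [tval] at h1
    have r1 : Rs g (i + 1) (l + 2) = Rs g (i + 1) (l + 1) + g (i + 1) (l + 1) := Rs_succ _ _ _
    simp only [Fin.val_succ, Fin.val_castSucc, add_assoc, Nat.reduceAdd] at *
    omega
  change 0 < ∑ g ∈ (GT l lam).filter (fun g => ¬ ∃ p : ℕ × ℕ, selp l P g p.1 p.2), F g
  rw [Finset.sum_congr rfl hF]
  refine Finset.sum_pos' (fun g _ => by split_ifs <;> simp) ⟨g₀, ?_, ?_⟩
  · rw [Finset.mem_filter, mem_GT_iff h0]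
    refine ⟨hg₀, ?_⟩
    rintro ⟨p, hp⟩
    have := hgood p.1 p.2 hp.1
    have := hp.2.1
    omega
  · rw [if_pos (funext hwt)]
    exact one_pos

/-! ### Part 5: the explicit good pattern -/

def gex (H : ℕ → ℕ) (a b c d : ℕ) : ℕ → ℕ → ℕ := fun k i =>
  if i < k then H i - (if a ≤ i ∧ i < b ∧ k = i + 1 then 1 else 0) - (if i = c ∧ k ≤ d then 1 else 0)
  else 0

structure Dat (l : ℕ) (G H P P' : ℕ → ℕ) (a b c d : ℕ) : Prop where
  hG : ∀ i j, i ≤ j → j < l → G j ≤ G i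
  hH : ∀ k, k + 1 < l → H (k + 1) ≤ H k
  hH0 : ∀ k, l ≤ k → H k = 0
  hHG : ∀ k < l, H k + (if k = b then 1 else 0) = G k + (if k = c then 1 else 0)
  hP : ∀ k, k + 1 < l → P (k + 1) ≤ P k
  hP' : ∀ k, k + 1 < l → P' (k + 1) ≤ P' k
  hPP : ∀ k < l, P' k + (if k = a then 1 else 0) = P k + (if k = d then 1 else 0)
  hb : b < l
  hd : d < l
  hbc : b ≠ c
  hab : a ≤ b
  hcd : c ≤ d
  had : a < d

/-- the exact subtraction in `gex` -/
theorem gex_eq {l : ℕ} {G H P P' : ℕ → ℕ} {a b c d : ℕ} (D : Dat l G H P P' a b c d) (k i : ℕ)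
    (hi : i < k) : (gex H a b c d k i : ℤ) =
      H i - (if a ≤ i ∧ i < b ∧ k = i + 1 then 1 else 0) - (if i = c ∧ k ≤ d then 1 else 0) := by
  obtain ⟨hG, hH, hH0, hHG, hP, hP', hPP, hb, hd, hbc, hab, hcd, had⟩ := D
  have hHb := hHG b hb
  rw [if_pos rfl, if_neg hbc] at hHb
  simp only [gex, if_pos hi]
  by_cases h1 : a ≤ i ∧ i < b ∧ k = i + 1
  · have hHi := hHG i (by omega)
    have hGi := hG i b (by omega) hb
    rw [if_neg (by omega)] at hHi
    by_cases h2 : i = c ∧ k ≤ d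
    · rw [if_pos h2.1] at hHi
      simp only [if_pos h1, if_pos h2]
      omega
    · simp only [if_pos h1, if_neg h2]
      omega
  · by_cases h2 : i = c ∧ k ≤ d
    · have hHi := hHG i (by omega)
      rw [if_pos h2.1, if_neg (by omega)] at hHi
      simp only [if_neg h1, if_pos h2]
      omega
    · simp only [if_neg h1, if_neg h2]
      omega

set_option maxHeartbeats 1000000 in
theorem gex_IsGT {l : ℕ} {G H P P' : ℕ → ℕ} {a b c d : ℕ} (D : Dat l G H P P' a b c d) :
    IsGT l H (gex H a b c d) := by
  have hge := gex_eq D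
  obtain ⟨hG, hH, hH0, hHG, hP, hP', hPP, hb, hd, hbc, hab, hcd, had⟩ := D
  refine ⟨?_, ?_, ?_⟩
  · intro k hk
    funext i
    by_cases hi : i < k
    · have := hge k i hi
      rw [if_neg (by omega), if_neg (by omega)] at this
      omega
    · rw [hH0 i (by omega), gex, if_neg hi]
  · intro k hk i hi
    rw [gex, if_neg (by omega)]
  · intro k hk i
    by_cases hi : i < k
    · have e1 := hge k i hi
      have e2 := hge (k + 1) i (by omega)
      have e3 := hge (k + 1) (i + 1) (by omega)
      have f1 := hHG i (by omega)
      have f2 := hHG (i + 1) (by omega)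
      have f3 := hH i (by omega)
      have f4 := hG i (i + 1) (by omega) (by omega)
      clear hge hG hH hH0 hHG hP hP' hPP
      generalize gex H a b c d k i = x1 at *
      generalize gex H a b c d (k + 1) i = x2 at *
      generalize gex H a b c d (k + 1) (i + 1) = x3 at *
      constructor
      · clear e2
        grind
      · clear e3 f1 f2
        grind
    · have e1 : gex H a b c d k i = 0 := by rw [gex, if_neg hi]
      have e2 : gex H a b c d (k + 1) (i + 1) = 0 := by rw [gex, if_neg (by omega)]
      omega

theorem Rs_gex {l : ℕ} {G H P P' : ℕ → ℕ} {a b c d : ℕ} (D : Dat l G H P P' a b c d) (k N : ℕ)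
    (hN : N ≤ k) : Rs (gex H a b c d) k N = ∑ j ∈ Finset.range N, (H j : ℤ)
      - (if a + 1 ≤ k ∧ k ≤ b ∧ k = N then 1 else 0) - (if c < N ∧ k ≤ d then 1 else 0) := by
  induction N with
  | zero => simp [Rs_zero]; omega
  | succ N ih =>
    rw [Rs_succ, ih (by omega), gex_eq D k N (by omega), Finset.sum_range_succ]
    split_ifs <;> omega

set_option maxHeartbeats 1000000 in
theorem gex_good {l : ℕ} {G H P P' : ℕ → ℕ} {a b c d : ℕ} (D : Dat l G H P P' a b c d) (i k : ℕ)
    (hk : k + 1 < l) : tval P (gex H a b c d) i k ≤ 0 := by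
  have key : ∀ i ≤ k, tval P (gex H a b c d) i k ≤ 0 := by
    intro i hi
    rw [tval, Rs_gex D _ _ (by omega), Rs_gex D _ _ (by omega), Rs_gex D _ _ (by omega),
      Rs_gex D _ _ (by omega)]
    obtain ⟨hG, hH, hH0, hHG, hP, hP', hPP, hb, hd, hbc, hab, hcd, had⟩ := D
    have f1 := hP k hk
    have f2 := hP' k hk
    have f3 := hPP k (by omega)
    have f4 := hPP (k + 1) hk
    generalize ∑ j ∈ Finset.range i, (H j : ℤ) = S1
    generalize ∑ j ∈ Finset.range (i + 1), (H j : ℤ) = S2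
    clear hG hH hH0 hHG hP hP' hPP
    by_cases hkd : k + 1 ≤ d
    · by_cases hik : i = k
      · subst hik
        by_cases hkd2 : i + 1 = d <;> by_cases hka : i = a <;> by_cases hkb : i + 1 ≤ b <;> grind
      · by_cases hkd2 : k + 1 = d <;> by_cases hka : k = a <;> by_cases hkb : k + 1 ≤ b <;> grind
    · by_cases hik : i = k
      · subst hik
        by_cases hkd2 : i = d <;> by_cases hka : i = a <;> by_cases hkb : i + 1 ≤ b <;> grind
      · by_cases hkd2 : k = d <;> by_cases hka : k = a <;> by_cases hkb : k + 1 ≤ b <;> grind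
  by_contra hc
  rcases Nat.lt_or_ge k i with h | h
  · have : ∀ e, ¬ 0 < tval P (gex H a b c d) (k + e) k := by
      intro e
      induction e with
      | zero => have := key k le_rfl; rw [add_zero]; omega
      | succ e ih =>
        intro h
        exact ih (tval_step (gex_IsGT D) hk (by omega) h)
    have := this (i - k)
    rw [show k + (i - k) = i by omega] at this
    omega
  · have := key i h
    omega

theorem gex_wt {l : ℕ} {G H P P' : ℕ → ℕ} {a b c d : ℕ} (D : Dat l G H P P' a b c d) (k : ℕ)
    (hk : k < l) : wt (gex H a b c d) k + P k = G k + P' k := by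
  have h1 := wt_eq (gex_IsGT D) hk (k + 1) (by omega)
  rw [Rs_succ _ k k, Rs_gex D _ _ le_rfl, Rs_gex D _ _ le_rfl, Finset.sum_range_succ] at h1
  have h2 : gex H a b c d k k = 0 := by rw [gex, if_neg (by omega)]
  obtain ⟨hG, hH, hH0, hHG, hP, hP', hPP, hb, hd, hbc, hab, hcd, had⟩ := D
  have f3 := hPP k (by omega)
  have f4 := hHG k hk
  generalize ∑ j ∈ Finset.range k, (H j : ℤ) = S1 at *
  clear hG hH hH0 hHG hP hP' hPP
  grind

theorem core (l : ℕ) (G H P P' : Fin l → ℕ) (a b c d : ℕ) (hH : Antitone H)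
    (D : Dat l (extz l G) (extz l H) (extz l P) (extz l P') a b c d) :
    0 < schurMult l (fun i => G i + P' i) (schur l H * schur l P) := by
  rw [schurMult, mul_assoc, schur_mul_vdm, coeff_schur_mul l H hH]
  have := sum_pos_of_good l (extz l H) D.hH0 (extz l P) D.hP
    (fun i => G i + P' i + (l - 1 - (i : ℕ))) ?_ (gex (extz l H) a b c d) (gex_IsGT D)
    (gex_good D) ?_
  · have e : ∀ i : Fin l, extz l P i = P i := by intro i; simp [extz]
    simpa only [e] using this
  · intro i j hij
    have hij' : (i : ℕ) < j := hij
    have hj := j.2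
    have hGij := D.hG i j hij'.le hj
    have hP'ij : P' j ≤ P' i := by
      have : ∀ e (h : (i : ℕ) + e < l), extz l P' (i + e) ≤ extz l P' i := by
        intro e
        induction e with
        | zero => simp
        | succ e ih => intro h; exact (D.hP' (i + e) (by omega)).trans (ih (by omega))
      have := this (j - i) (by omega)
      rw [show (i : ℕ) + (j - i) = j by omega] at this
      simpa [extz] using this
    simp only [extz, Fin.is_lt, dite_true, Fin.eta] at hGij
    change G j + P' j + _ < G i + P' i + _
    omega
  · intro i
    have := gex_wt D i i.2
    have e1 : extz l G i = G i := by simp [extz]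
    have e2 : extz l P' i = P' i := by simp [extz]
    rw [e1, e2] at this
    omega

/-! ### Part 6: combinatorics of blocks -/

theorem bsize_pos {l ι : ℕ} {f : Fin l → Fin ι} (i : Fin l) : 0 < bsize l ι f (f i) :=
  Finset.card_pos.2 ⟨i, by simp⟩

theorem GJ_antitone {l ι : ℕ} {A : Fin l → ℕ} (hA : Antitone A) {f : Fin l → Fin ι} (hf : Monotone f) :
    Antitone (GJ l ι f A) := by
  intro i j hij
  rcases (hf hij).lt_or_eq with hlt | heq
  · have hs1 := bsize_pos (f := f) i
    have hs2 := bsize_pos (f := f) j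
    have hd : ∀ i, bsize l ι f (f i) ∣ Lnum l := by
      intro i
      refine Finset.dvd_lcm (f := id) (b := bsize l ι f (f i)) ?_
      rw [Finset.mem_Icc]
      refine ⟨bsize_pos i, ?_⟩
      exact (Finset.card_le_univ _).trans (by simp)
    obtain ⟨q1, h1⟩ := hd i
    obtain ⟨q2, h2⟩ := hd j
    have hcross : bsize l ι f (f i) * bsum l ι f A (f j) ≤ bsize l ι f (f j) * bsum l ι f A (f i) := by
      have e1 : bsize l ι f (f i) * bsum l ι f A (f j) =
          ∑ x ∈ Finset.univ.filter (fun x => f x = f i), ∑ y ∈ Finset.univ.filter (fun y => f y = f j), A y := by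
        simp [bsize, bsum]
      have e2 : bsize l ι f (f j) * bsum l ι f A (f i) =
          ∑ x ∈ Finset.univ.filter (fun x => f x = f i), ∑ y ∈ Finset.univ.filter (fun y => f y = f j), A x := by
        simp [bsize, bsum, Finset.mul_sum]
      rw [e1, e2]
      refine Finset.sum_le_sum fun x hx => Finset.sum_le_sum fun y hy => ?_
      simp only [Finset.mem_filter, Finset.mem_univ, true_and] at hx hy
      apply hA
      by_contra hc
      have := hf (not_le.1 hc).le
      rw [hx, hy] at this
      exact absurd this (not_le.2 hlt)
    have g1 : GJ l ι f A i = q1 * bsum l ι f A (f i) := by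
      rw [GJ]; congr 1; rw [h1]; exact Nat.mul_div_cancel_left _ hs1
    have g2 : GJ l ι f A j = q2 * bsum l ι f A (f j) := by
      rw [GJ]; congr 1; rw [h2]; exact Nat.mul_div_cancel_left _ hs2
    rw [g1, g2]
    have hL : bsize l ι f (f i) * q1 = bsize l ι f (f j) * q2 := by rw [← h1, ← h2]
    refine Nat.le_of_mul_le_mul_left ?_ (Nat.mul_pos hs1 hs2)
    calc bsize l ι f (f i) * bsize l ι f (f j) * (q2 * bsum l ι f A (f j))
        = (bsize l ι f (f j) * q2) * (bsize l ι f (f i) * bsum l ι f A (f j)) := by ring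
      _ ≤ (bsize l ι f (f j) * q2) * (bsize l ι f (f j) * bsum l ι f A (f i)) :=
          Nat.mul_le_mul_left _ hcross
      _ = bsize l ι f (f i) * bsize l ι f (f j) * (q1 * bsum l ι f A (f i)) := by
          rw [← hL]; ring
  · simp only [GJ, heq, le_refl]

theorem lt_bend_iff {l ι : ℕ} {f : Fin l → Fin ι} (hf : Monotone f) (j : Fin ι) (i : Fin l) :
    (i : ℕ) < bend l ι f j ↔ f i ≤ j := by
  constructor
  · intro h
    by_contra hc
    have : Finset.univ.filter (fun x => f x ≤ j) ⊆ Finset.Iio i := by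
      intro x hx
      simp only [Finset.mem_filter, Finset.mem_univ, true_and] at hx
      rw [Finset.mem_Iio]
      by_contra hh
      exact hc ((hf (not_lt.1 hh)).trans hx)
    have := Finset.card_le_card this
    rw [Fin.card_Iio] at this
    rw [bend] at h
    omega
  · intro h
    have : Finset.Iic i ⊆ Finset.univ.filter (fun x => f x ≤ j) := by
      intro x hx
      simp only [Finset.mem_filter, Finset.mem_univ, true_and]
      rw [Finset.mem_Iic] at hx
      exact (hf hx).trans h
    have := Finset.card_le_card this
    rw [Fin.card_Iic] at this
    rw [bend]
    omega

theorem lt_bstart_iff {l ι : ℕ} {f : Fin l → Fin ι} (hf : Monotone f) (j : Fin ι) (i : Fin l) :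
    (i : ℕ) < bstart l ι f j ↔ f i < j := by
  constructor
  · intro h
    by_contra hc
    have : Finset.univ.filter (fun x => f x < j) ⊆ Finset.Iio i := by
      intro x hx
      simp only [Finset.mem_filter, Finset.mem_univ, true_and] at hx
      rw [Finset.mem_Iio]
      by_contra hh
      exact hc ((hf (not_lt.1 hh)).trans_lt hx)
    have := Finset.card_le_card this
    rw [Fin.card_Iio] at this
    rw [bstart] at h
    omega
  · intro h
    have : Finset.Iic i ⊆ Finset.univ.filter (fun x => f x < j) := by
      intro x hx
      simp only [Finset.mem_filter, Finset.mem_univ, true_and]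
      rw [Finset.mem_Iic] at hx
      exact (hf hx).trans_lt h
    have := Finset.card_le_card this
    rw [Fin.card_Iic] at this
    rw [bstart]
    omega

theorem bstart_add_bsize {l ι : ℕ} (f : Fin l → Fin ι) (j : Fin ι) :
    bstart l ι f j + bsize l ι f j = bend l ι f j := by
  rw [bstart, bsize, bend, ← Finset.card_union_of_disjoint]
  · congr 1
    ext x
    simp [le_iff_lt_or_eq]
  · rw [Finset.disjoint_filter]
    intro x _ h1 h2
    exact absurd h2 h1.ne

theorem bend_le_bstart {l ι : ℕ} (f : Fin l → Fin ι) {m n : Fin ι} (h : m < n) :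
    bend l ι f m ≤ bstart l ι f n := by
  refine Finset.card_le_card ?_
  intro x hx
  simp only [Finset.mem_filter, Finset.mem_univ, true_and] at hx ⊢
  exact hx.trans_lt h

theorem box_diff {l : ℕ} {P P' : Fin l → ℕ} {α : Fin l} {α' : ℕ}
    (h : YD l P \ YD l P' = {(α, α')}) :
    P α = P' α + 1 ∧ ∀ i, i ≠ α → P i ≤ P' i := by
  have hmem : ∀ i j, (j < P i ∧ ¬ j < P' i) ↔ (i = α ∧ j = α') := by
    intro i j
    have := Set.ext_iff.1 h (i, j)
    simpa [YD] using this
  constructor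
  · have h1 := (hmem α α').2 ⟨rfl, rfl⟩
    have h2 := (hmem α (P' α)).1 ⟨by omega, by omega⟩
    have h3 := (hmem α (P α - 1)).1 ⟨by omega, by omega⟩
    omega
  · intro i hi
    by_contra hc
    exact hi ((hmem i (P' i)).1 ⟨by omega, by omega⟩).1

/-- Let `A` be a partition of length at most `l`, `f` a subdivision of
`{1,…,l}`, and `m`, `n` block indices such that `H_J(A,m,n)` is a partition and either
`m < n`, or `m = n` and `|I_m| > 1`. Let `P ≻ P'` be partitions of equal weight whose
Young diagrams differ by the single boxes `(α,α')` and `(γ,γ')`, with `J(α) ≤ m` and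
`n ≤ J(γ)`. Then `G_J(A) + P'` has positive multiplicity in `s_{H_J(A,m,n)} · s_P`. -/
theorem HJ_mul_schur_contains (l ι : ℕ) (hl : 0 < l) (A : Fin l → ℕ) (hA : Antitone A)
    (f : Fin l → Fin ι) (hf : Monotone f) (hsurj : Function.Surjective f)
    (m n : Fin ι)
    (hH1 : Antitone (HJ l ι f A m n)) (hH2 : ∀ i, 0 ≤ HJ l ι f A m n i)
    (hmn : m < n ∨ (m = n ∧ 1 < bsize l ι f m))
    (P P' : Fin l → ℕ) (hP : Antitone P) (hP' : Antitone P')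
    (hw : ∑ i, P i = ∑ i, P' i) (hdom : Dom l P P') (hne : P ≠ P')
    (α γ : Fin l) (α' γ' : ℕ)
    (hbox1 : YD l P \ YD l P' = {(α, α')}) (hbox2 : YD l P' \ YD l P = {(γ, γ')})
    (hα : f α ≤ m) (hγ : n ≤ f γ) :
    0 < schurMult l (fun i => GJ l ι f A i + P' i)
      (schur l (fun i => (HJ l ι f A m n i).toNat) * schur l P) := by
  obtain ⟨p1, p2⟩ := box_diff hbox1
  obtain ⟨p3, p4⟩ := box_diff hbox2
  have hPP : ∀ k : Fin l, P' k + (if k = α then 1 else 0) = P k + (if k = γ then 1 else 0) := by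
    intro k
    by_cases h1 : k = α
    · subst h1
      have h2 : k ≠ γ := by rintro rfl; omega
      rw [if_pos rfl, if_neg h2]; omega
    · rw [if_neg h1]
      by_cases h2 : k = γ
      · subst h2; rw [if_pos rfl]; omega
      · rw [if_neg h2]
        have := p2 k h1
        have := p4 k h2
        omega
  have hαγ : α < γ := by
    by_contra hc
    have hne' : α ≠ γ := by rintro rfl; omega
    have hlt : γ < α := lt_of_le_of_ne (not_lt.1 hc) hne'.symm
    have h1 := hdom (γ + 1)
    have h2 : ∑ i ∈ Finset.univ.filter (fun i : Fin l => (i : ℕ) < γ + 1), P i <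
        ∑ i ∈ Finset.univ.filter (fun i : Fin l => (i : ℕ) < γ + 1), P' i := by
      refine Finset.sum_lt_sum ?_ ⟨γ, by simp, by omega⟩
      intro i hi
      simp only [Finset.mem_filter, Finset.mem_univ, true_and] at hi
      apply p2
      rintro rfl
      have : (γ : ℕ) < i := hlt
      omega
    omega
  have ba := (lt_bend_iff hf m α).2 hα
  have bc : bstart l ι f n ≤ γ := by
    by_contra hc
    exact absurd ((lt_bstart_iff hf n γ).1 (by omega)) (not_lt.2 hγ)
  have bel : bend l ι f m ≤ l := (Finset.card_le_univ _).trans (by simp)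
  have hbc : bend l ι f m - 1 ≠ bstart l ι f n := by
    rcases hmn with h | ⟨rfl, h⟩
    · have := bend_le_bstart f h
      omega
    · have := bstart_add_bsize f m
      omega
  have hGa := GJ_antitone hA hf
  have hHa : Antitone (fun i => (HJ l ι f A m n i).toNat) := by
    intro i j hij
    exact Int.toNat_le_toNat (hH1 hij)
  refine core l (GJ l ι f A) _ P P' α (bend l ι f m - 1) (bstart l ι f n) γ hHa ?_
  have hγl := γ.2
  have hαγ' : (α : ℕ) < γ := hαγ
  have hstep : ∀ (Q : Fin l → ℕ), Antitone Q → ∀ i j, i ≤ j → j < l → extz l Q j ≤ extz l Q i := by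
    intro Q hQ i j hij hj
    have hi : i < l := by omega
    simp only [extz, dif_pos hj, dif_pos hi]
    exact hQ (by simpa using hij)
  refine ⟨hstep _ hGa, fun k hk => hstep _ hHa _ _ (by omega) hk, ?_, ?_,
    fun k hk => hstep _ hP _ _ (by omega) hk, fun k hk => hstep _ hP' _ _ (by omega) hk, ?_,
    by omega, hγl, hbc, by omega, bc, hαγ'⟩
  · intro k hk
    simp [extz, hk]
  · intro k hk
    have h1 := hH2 ⟨k, hk⟩
    simp only [extz, dif_pos hk]
    simp only [HJ] at h1 ⊢
    split_ifs at * <;> omega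
  · intro k hk
    have := hPP ⟨k, hk⟩
    simp only [extz, dif_pos hk]
    simpa [Fin.ext_iff] using this
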